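/- Let y ∈ ℝ^n satisfy the algebraic equation q + Eᵀ Γ R_Eᵀ y + (u_max/2) Hᵀ ( (R_Dᵀ y + v) − |R_Dᵀ y + v|_elem ) = 0, and define the constant control u* ∈ ℝ^{m_u} by u*_k := (u_max/2)·(1 − sign( ⟨y, r_k^D⟩ + v_k )). Then u* ∈ [0, u_max]^{m_u}, and for every x ∈ ℝ^n with nonnegative entries and every u ∈ [0, u_max]^{m_u}: Σ_{k=1}^{m_u} ( v_k + ⟨y, r_k^D⟩ ) u*_k (Hx)_k ≤ Σ_{k=1}^{m_u} ( v_k + ⟨y, r_k^D⟩ ) u_k (Hx)_k. In particular the same constant control u*, independent of both the state x and of time, attains the minimum in the stationary Hamilton–Jacobi–Bellman equation at every nonnegative state. -/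

import Mathlib

/-- The bang-bang control `(M / 2) * (1 - sign c)` lies in `[0, M]`. -/
theorem half_mul_one_sub_sign_mem_Icc {M : ℝ} (hM : 0 ≤ M) (c : ℝ) :
    M / 2 * (1 - Real.sign c) ∈ Set.Icc 0 M := by
  rcases Real.sign_apply_eq c with h | h | h <;> rw [h] <;> constructor <;> linarith

/-- The bang-bang control `(M / 2) * (1 - sign c)` minimizes `w ↦ c * w` over `[0, M]`. -/
theorem mul_half_mul_one_sub_sign_le {M c w : ℝ} (hw : w ∈ Set.Icc 0 M) :
    c * (M / 2 * (1 - Real.sign c)) ≤ c * w := by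
  obtain ⟨hw0, hwM⟩ := hw
  rcases lt_trichotomy c 0 with h | rfl | h
  · rw [Real.sign_of_neg h]
    nlinarith
  · simp
  · rw [Real.sign_of_pos h]
    nlinarith

/-- The infinite-horizon optimal routing policy of Proposition 2 is constant:
`u*_k = (u_max/2) * (1 - sign(⟨y, r_k^D⟩ + v_k))` is admissible and attains the minimum in the
stationary HJB equation at every nonnegative state `x`, independently of the state and of time. -/
theorem infinite_horizon_policy_no_state_feedback (n me mu : ℕ) (u_max : ℝ) (hu : 0 < u_max)
    (RE : Matrix (Fin n) (Fin me) ℝ) (RD : Matrix (Fin n) (Fin mu) ℝ)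
    (gam : Fin me → ℝ) (hgam : ∀ j, 0 ≤ gam j)
    (E : Matrix (Fin me) (Fin n) ℝ) (hE : ∀ j i, E j i = 0 ∨ E j i = 1)
    (H : Matrix (Fin mu) (Fin n) ℝ) (hH : ∀ k i, H k i = 0 ∨ H k i = 1)
    (q : Fin n → ℝ) (hq : ∀ i, 0 ≤ q i)
    (v : Fin mu → ℝ) (hv : ∀ k, 0 ≤ v k)
    (y : Fin n → ℝ)
    (halg : q + (E.transpose * Matrix.diagonal gam * RE.transpose).mulVec y
        + (u_max / 2) • H.transpose.mulVec
            (fun k => (RD.transpose.mulVec y + v) k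
              - |(RD.transpose.mulVec y + v) k|) = 0)
    (ustar : Fin mu → ℝ)
    (hustar : ∀ k, ustar k
      = (u_max / 2) * (1 - Real.sign ((∑ i, y i * RD i k) + v k))) :
    (∀ k, ustar k ∈ Set.Icc (0 : ℝ) u_max) ∧
    ∀ x : Fin n → ℝ, (∀ i, 0 ≤ x i) →
      ∀ u : Fin mu → ℝ, (∀ k, u k ∈ Set.Icc (0 : ℝ) u_max) →
        ∑ k, (v k + ∑ i, y i * RD i k) * ustar k * H.mulVec x k ≤
          ∑ k, (v k + ∑ i, y i * RD i k) * u k * H.mulVec x k := by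
  refine ⟨fun k => hustar k ▸ half_mul_one_sub_sign_mem_Icc hu.le _, fun x hx u hmem => ?_⟩
  refine Finset.sum_le_sum fun k _ => mul_le_mul_of_nonneg_right ?_ ?_
  · rw [hustar k, add_comm (v k)]
    exact mul_half_mul_one_sub_sign_le (hmem k)
  · rw [Matrix.mulVec, dotProduct]
    refine Finset.sum_nonneg fun i _ => mul_nonneg ?_ (hx i)
    rcases hH k i with h | h <;> simp [h]
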